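/- Consider the difference equation u_{n+1} = A_nu_n with invertible, uniformly bounded A_n ∈ ℝ^{d×d} whose inverses are uniformly bounded, and the kinematically transformed system with matrices Ã_n = Q_{n+1}A_nQ_n⁻¹ where Q_n ∈ GL(ℝ^d) satisfy lim_{n→∞} Q_n = Q with Q orthogonal. Then for every 1 ≤ s ≤ d each of the four angular values θ_s^{sup,limsup}, θ_s^{sup,liminf}, θ_s^{limsup,sup}, θ_s^{liminf,sup} of the system (A_n) coincides with the corresponding angular value of the system (Ã_n). -/

import Mathlib

open scoped Matrix RealInnerProductSpace
open Module Filter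

noncomputable def maxAngle {d : ℕ} (V W : Submodule ℝ (EuclideanSpace ℝ (Fin d))) : ℝ :=
  Real.arccos (sInf {r : ℝ | ∃ v ∈ V, ‖v‖ = 1 ∧
    r = sSup {c : ℝ | ∃ w ∈ W, ‖w‖ = 1 ∧ c = ⟪v, w⟫}})

/-- The spectral norm of a real matrix. -/
noncomputable def sNorm {m n : ℕ} (A : Matrix (Fin m) (Fin n) ℝ) : ℝ :=
  ‖LinearMap.toContinuousLinearMap (Matrix.toEuclideanLin A)‖

/-- The image `SV = {Sv : v ∈ V}` of a subspace under a matrix. -/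
noncomputable def mapMat {d : ℕ} (S : Matrix (Fin d) (Fin d) ℝ)
    (V : Submodule ℝ (EuclideanSpace ℝ (Fin d))) : Submodule ℝ (EuclideanSpace ℝ (Fin d)) :=
  V.map (Matrix.toEuclideanLin S)

/-- The solution operator `Φ(n,0) = A_{n−1} ⋯ A_0` of `u_{n+1} = A_n u_n`. -/
def PhiD {d : ℕ} (A : ℕ → Matrix (Fin d) (Fin d) ℝ) : ℕ → Matrix (Fin d) (Fin d) ℝ
  | 0 => 1
  | n + 1 => A n * PhiD A n

/-- `a_{1,n}(V) = Σ_{j=1}^n ∠(Φ(j−1,0)V, Φ(j,0)V)`. -/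
noncomputable def aDisc {d : ℕ} (A : ℕ → Matrix (Fin d) (Fin d) ℝ)
    (V : Submodule ℝ (EuclideanSpace ℝ (Fin d))) (n : ℕ) : ℝ :=
  ∑ j ∈ Finset.range n, maxAngle (mapMat (PhiD A j) V) (mapMat (PhiD A (j + 1)) V)

/-- The outer angular value `θ_s^{sup,limsup}`. -/
noncomputable def thSupLimsup {d : ℕ} (s : ℕ) (A : ℕ → Matrix (Fin d) (Fin d) ℝ) : ℝ :=
  ⨆ V : {V : Submodule ℝ (EuclideanSpace ℝ (Fin d)) // finrank ℝ V = s},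
    limsup (fun n : ℕ => aDisc A V.1 n / n) atTop

/-- The outer angular value `θ_s^{sup,liminf}`. -/
noncomputable def thSupLiminf {d : ℕ} (s : ℕ) (A : ℕ → Matrix (Fin d) (Fin d) ℝ) : ℝ :=
  ⨆ V : {V : Submodule ℝ (EuclideanSpace ℝ (Fin d)) // finrank ℝ V = s},
    liminf (fun n : ℕ => aDisc A V.1 n / n) atTop

/-- The inner angular value `θ_s^{limsup,sup}`. -/
noncomputable def thLimsupSup {d : ℕ} (s : ℕ) (A : ℕ → Matrix (Fin d) (Fin d) ℝ) : ℝ :=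
  limsup (fun n : ℕ =>
    ⨆ V : {V : Submodule ℝ (EuclideanSpace ℝ (Fin d)) // finrank ℝ V = s},
      aDisc A V.1 n / n) atTop

/-- The inner angular value `θ_s^{liminf,sup}`. -/
noncomputable def thLiminfSup {d : ℕ} (s : ℕ) (A : ℕ → Matrix (Fin d) (Fin d) ℝ) : ℝ :=
  liminf (fun n : ℕ =>
    ⨆ V : {V : Submodule ℝ (EuclideanSpace ℝ (Fin d)) // finrank ℝ V = s},
      aDisc A V.1 n / n) atTop

lemma mapMat_mul {d : ℕ} (S T : Matrix (Fin d) (Fin d) ℝ)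
    (V : Submodule ℝ (EuclideanSpace ℝ (Fin d))) :
    mapMat (S * T) V = mapMat S (mapMat T V) := by
  unfold mapMat
  rw [← Submodule.map_comp]
  congr 1
  ext x i
  simp [Matrix.toLpLin_apply]

lemma mapMat_one {d : ℕ} (V : Submodule ℝ (EuclideanSpace ℝ (Fin d))) :
    mapMat 1 V = V := by
  unfold mapMat
  have : Matrix.toEuclideanLin (1 : Matrix (Fin d) (Fin d) ℝ) = LinearMap.id := by
    ext x i
    simp [Matrix.toLpLin_apply]
  rw [this, Submodule.map_id]

lemma finrank_mapMat {d : ℕ} (S : Matrix (Fin d) (Fin d) ℝ) (hS : IsUnit S)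
    (V : Submodule ℝ (EuclideanSpace ℝ (Fin d))) :
    finrank ℝ (mapMat S V) = finrank ℝ V := by
  apply le_antisymm
  · exact Submodule.finrank_map_le _ _
  · have h : mapMat S⁻¹ (mapMat S V) = V := by
      rw [← mapMat_mul, Matrix.nonsing_inv_mul _ ((Matrix.isUnit_iff_isUnit_det _).1 hS),
        mapMat_one]
    conv_lhs => rw [← h]
    exact Submodule.finrank_map_le _ _

lemma isUnit_PhiD {d : ℕ} (A : ℕ → Matrix (Fin d) (Fin d) ℝ) (h : ∀ n, IsUnit (A n)) (n : ℕ) :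
    IsUnit (PhiD A n) := by
  induction n with
  | zero => exact isUnit_one
  | succ k ih => exact (h k).mul ih

lemma PhiD_transform {d : ℕ} (A At Q : ℕ → Matrix (Fin d) (Fin d) ℝ) (hQ : ∀ n, IsUnit (Q n))
    (hAt : ∀ n, At n = Q (n + 1) * A n * (Q n)⁻¹) (n : ℕ) :
    PhiD At n * Q 0 = Q n * PhiD A n := by
  induction n with
  | zero => simp [PhiD]
  | succ k ih =>
    simp only [PhiD]
    rw [mul_assoc, ih, hAt, mul_assoc, ← mul_assoc (Q k)⁻¹,
      Matrix.nonsing_inv_mul _ ((Matrix.isUnit_iff_isUnit_det _).1 (hQ k)), one_mul, mul_assoc]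

lemma exists_unit {d : ℕ} (V : Submodule ℝ (EuclideanSpace ℝ (Fin d))) (h : 1 ≤ finrank ℝ V) :
    ∃ v ∈ V, ‖v‖ = 1 := by
  have hV : V ≠ ⊥ := by
    rintro rfl
    simp at h
  obtain ⟨x, hx, hx0⟩ := V.ne_bot_iff.1 hV
  exact ⟨‖x‖⁻¹ • x, V.smul_mem _ hx, by
    rw [norm_smul, norm_inv, norm_norm, inv_mul_cancel₀ (norm_ne_zero_iff.2 hx0)]⟩

noncomputable def mval {d : ℕ} (V W : Submodule ℝ (EuclideanSpace ℝ (Fin d))) : ℝ :=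
  sInf {r : ℝ | ∃ v ∈ V, ‖v‖ = 1 ∧
    r = sSup {c : ℝ | ∃ w ∈ W, ‖w‖ = 1 ∧ c = ⟪v, w⟫}}

lemma abs_inner_unit {d : ℕ} {v w : EuclideanSpace ℝ (Fin d)} (hv : ‖v‖ = 1) (hw : ‖w‖ = 1) :
    |⟪v, w⟫| ≤ 1 := by
  have := abs_real_inner_le_norm v w
  rwa [hv, hw, one_mul] at this

lemma inner_bdd {d : ℕ} (W : Submodule ℝ (EuclideanSpace ℝ (Fin d)))
    (v : EuclideanSpace ℝ (Fin d)) (hv : ‖v‖ = 1) :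
    BddAbove {c : ℝ | ∃ w ∈ W, ‖w‖ = 1 ∧ c = ⟪v, w⟫} := by
  refine ⟨1, ?_⟩
  rintro c ⟨w, -, hw, rfl⟩
  exact (abs_le.1 (abs_inner_unit hv hw)).2

lemma mval_le {d : ℕ} (V W V' W' : Submodule ℝ (EuclideanSpace ℝ (Fin d)))
    (hV' : ∃ v ∈ V', ‖v‖ = 1) (hW : ∃ v ∈ W, ‖v‖ = 1) (δ : ℝ)
    (P R : EuclideanSpace ℝ (Fin d) → EuclideanSpace ℝ (Fin d) → Prop)
    (hP : ∀ v' ∈ V', ‖v'‖ = 1 → ∃ v ∈ V, ‖v‖ = 1 ∧ P v v')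
    (hR : ∀ w ∈ W, ‖w‖ = 1 → ∃ w' ∈ W', ‖w'‖ = 1 ∧ R w w')
    (hPR : ∀ v v' w w', P v v' → R w w' → ⟪v, w⟫ ≤ ⟪v', w'⟫ + δ) :
    mval V W ≤ mval V' W' + δ := by
  rw [← sub_le_iff_le_add]
  unfold mval
  apply le_csInf
  · obtain ⟨v, h1, h2⟩ := hV'
    exact ⟨_, v, h1, h2, rfl⟩
  rintro r ⟨v', hv', hn', rfl⟩
  obtain ⟨v, hv, hn, hvv⟩ := hP v' hv' hn'
  rw [sub_le_iff_le_add]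
  have h1 : sInf {r : ℝ | ∃ v ∈ V, ‖v‖ = 1 ∧
      r = sSup {c : ℝ | ∃ w ∈ W, ‖w‖ = 1 ∧ c = ⟪v, w⟫}} ≤
      sSup {c : ℝ | ∃ w ∈ W, ‖w‖ = 1 ∧ c = ⟪v, w⟫} := by
    apply csInf_le
    · refine ⟨-1, ?_⟩
      rintro r ⟨x, hx, hx1, rfl⟩
      obtain ⟨w, hw, hw1⟩ := hW
      exact (abs_le.1 (abs_inner_unit hx1 hw1)).1.trans
        (le_csSup (inner_bdd W x hx1) ⟨w, hw, hw1, rfl⟩)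
    · exact ⟨v, hv, hn, rfl⟩
  refine h1.trans ?_
  apply csSup_le
  · obtain ⟨w, h1, h2⟩ := hW
    exact ⟨_, w, h1, h2, rfl⟩
  rintro c ⟨w, hw, hw1, rfl⟩
  obtain ⟨w', hw', hw1', hww⟩ := hR w hw hw1
  have h2 := hPR v v' w w' hvv hww
  have h3 := le_csSup (inner_bdd W' v' hn') ⟨w', hw', hw1', rfl⟩
  linarith

/-- The second vector is the normalised image of the first one, a unit vector. -/
def NormRel {d : ℕ} (S : Matrix (Fin d) (Fin d) ℝ) (v v' : EuclideanSpace ℝ (Fin d)) : Prop :=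
  ‖v‖ = 1 ∧ ‖v'‖ = 1 ∧ ∃ c : ℝ, 0 < c ∧ v' = c • Matrix.toEuclideanLin S v

lemma toEuclideanLin_inv_apply {d : ℕ} (S : Matrix (Fin d) (Fin d) ℝ) (hS : IsUnit S)
    (x : EuclideanSpace ℝ (Fin d)) :
    Matrix.toEuclideanLin S⁻¹ (Matrix.toEuclideanLin S x) = x := by
  ext i
  simp [Matrix.toLpLin_apply, Matrix.nonsing_inv_mul _ ((Matrix.isUnit_iff_isUnit_det _).1 hS)]

lemma Rel_forward {d : ℕ} (S : Matrix (Fin d) (Fin d) ℝ) (hS : IsUnit S)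
    (V : Submodule ℝ (EuclideanSpace ℝ (Fin d))) :
    ∀ v ∈ V, ‖v‖ = 1 → ∃ v' ∈ mapMat S V, ‖v'‖ = 1 ∧ NormRel S v v' := by
  intro v hv h1
  have h0 : Matrix.toEuclideanLin S v ≠ 0 := by
    intro h
    have := toEuclideanLin_inv_apply S hS v
    rw [h, map_zero] at this
    rw [← this] at h1
    simp at h1
  have h2 : ‖‖Matrix.toEuclideanLin S v‖⁻¹ • Matrix.toEuclideanLin S v‖ = 1 := by
    rw [norm_smul, norm_inv, norm_norm, inv_mul_cancel₀ (norm_ne_zero_iff.2 h0)]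
  exact ⟨‖Matrix.toEuclideanLin S v‖⁻¹ • Matrix.toEuclideanLin S v,
    Submodule.smul_mem _ _ (Submodule.mem_map_of_mem hv), h2, h1, h2, _,
    inv_pos.2 (norm_pos_iff.2 h0), rfl⟩

lemma Rel_backward {d : ℕ} (S : Matrix (Fin d) (Fin d) ℝ)
    (V : Submodule ℝ (EuclideanSpace ℝ (Fin d))) :
    ∀ v' ∈ mapMat S V, ‖v'‖ = 1 → ∃ v ∈ V, ‖v‖ = 1 ∧ NormRel S v v' := by
  rintro v' ⟨x, hx, rfl⟩ h1
  have h0 : x ≠ 0 := by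
    rintro rfl
    simp at h1
  have h2 : ‖‖x‖⁻¹ • x‖ = 1 := by
    rw [norm_smul, norm_inv, norm_norm, inv_mul_cancel₀ (norm_ne_zero_iff.2 h0)]
  refine ⟨‖x‖⁻¹ • x, V.smul_mem _ hx, h2, h2, h1, ‖x‖, norm_pos_iff.2 h0, ?_⟩
  rw [map_smul, smul_smul, mul_inv_cancel₀ (norm_ne_zero_iff.2 h0), one_smul]

lemma inner_orth {d : ℕ} (O : Matrix (Fin d) (Fin d) ℝ) (hO : Oᵀ * O = 1)
    (v w : EuclideanSpace ℝ (Fin d)) :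
    ⟪Matrix.toEuclideanLin O v, Matrix.toEuclideanLin O w⟫ = ⟪v, w⟫ := by
  rw [EuclideanSpace.inner_eq_star_dotProduct, EuclideanSpace.inner_eq_star_dotProduct]
  simp only [Matrix.toLpLin_apply, star_trivial]
  rw [Matrix.dotProduct_mulVec, ← Matrix.mulVec_transpose, Matrix.mulVec_mulVec, hO,
    Matrix.one_mulVec]

lemma norm_orth {d : ℕ} (O : Matrix (Fin d) (Fin d) ℝ) (hO : Oᵀ * O = 1)
    (v : EuclideanSpace ℝ (Fin d)) : ‖Matrix.toEuclideanLin O v‖ = ‖v‖ := by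
  rw [@norm_eq_sqrt_real_inner _ _ _ (Matrix.toEuclideanLin O v), inner_orth O hO,
    ← norm_eq_sqrt_real_inner]

lemma Rel_close {d : ℕ} (S O : Matrix (Fin d) (Fin d) ℝ) (hO : Oᵀ * O = 1)
    (v v' : EuclideanSpace ℝ (Fin d)) (h : NormRel S v v') :
    ‖v' - Matrix.toEuclideanLin O v‖ ≤ 2 * sNorm (S - O) := by
  obtain ⟨h1, h2, c, hc, rfl⟩ := h
  set y := Matrix.toEuclideanLin S v
  have hd : ‖y - Matrix.toEuclideanLin O v‖ ≤ sNorm (S - O) := by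
    have := (LinearMap.toContinuousLinearMap (Matrix.toEuclideanLin (S - O))).le_opNorm v
    rw [h1, mul_one] at this
    simpa [sNorm, y] using this
  have hcy : c * ‖y‖ = 1 := by
    rwa [norm_smul, Real.norm_of_nonneg hc.le] at h2
  have h3 : ‖c • y - y‖ = |1 - ‖y‖| := by
    have : c • y - y = (c - 1) • y := by rw [sub_smul, one_smul]
    rw [this, norm_smul, Real.norm_eq_abs, ← abs_norm y, ← abs_mul, abs_norm, sub_mul, hcy, one_mul]
  have h4 : |1 - ‖y‖| ≤ ‖y - Matrix.toEuclideanLin O v‖ := by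
    have := abs_norm_sub_norm_le y (Matrix.toEuclideanLin O v)
    rwa [norm_orth O hO, h1, abs_sub_comm] at this
  have h5 := norm_sub_le_norm_sub_add_norm_sub (c • y) y (Matrix.toEuclideanLin O v)
  linarith

lemma Rel_inner {d : ℕ} (S T O : Matrix (Fin d) (Fin d) ℝ) (hO : Oᵀ * O = 1)
    (v v' w w' : EuclideanSpace ℝ (Fin d)) (hv : NormRel S v v') (hw : NormRel T w w') :
    |⟪v', w'⟫ - ⟪v, w⟫| ≤ 2 * sNorm (S - O) + 2 * sNorm (T - O) := by
  rw [← inner_orth O hO v w]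
  have e : ⟪v', w'⟫ - ⟪Matrix.toEuclideanLin O v, Matrix.toEuclideanLin O w⟫ =
      ⟪v' - Matrix.toEuclideanLin O v, w'⟫ +
      ⟪Matrix.toEuclideanLin O v, w' - Matrix.toEuclideanLin O w⟫ := by
    rw [inner_sub_left, inner_sub_right]
    ring
  rw [e]
  refine (abs_add_le _ _).trans (add_le_add ?_ ?_)
  · refine (abs_real_inner_le_norm _ _).trans ?_
    rw [hw.2.1, mul_one]
    exact Rel_close S O hO v v' hv
  · refine (abs_real_inner_le_norm _ _).trans ?_
    rw [norm_orth O hO, hv.1, one_mul]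
    exact Rel_close T O hO w w' hw

lemma mval_close {d : ℕ} (S T O : Matrix (Fin d) (Fin d) ℝ) (hO : Oᵀ * O = 1)
    (hS : IsUnit S) (hT : IsUnit T) (V W : Submodule ℝ (EuclideanSpace ℝ (Fin d)))
    (hV : 1 ≤ finrank ℝ V) (hW : 1 ≤ finrank ℝ W) :
    |mval (mapMat S V) (mapMat T W) - mval V W| ≤ 2 * sNorm (S - O) + 2 * sNorm (T - O) := by
  have a := mval_le V W (mapMat S V) (mapMat T W)
    (exists_unit _ (by rwa [finrank_mapMat S hS])) (exists_unit _ hW)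
    (2 * sNorm (S - O) + 2 * sNorm (T - O)) (NormRel S) (NormRel T) (Rel_backward S V)
    (Rel_forward T hT W) (fun v v' w w' hv hw => by
      have := (abs_le.1 (Rel_inner S T O hO v v' w w' hv hw)).1
      linarith)
  have b := mval_le (mapMat S V) (mapMat T W) V W
    (exists_unit _ hV) (exists_unit _ (by rwa [finrank_mapMat T hT]))
    (2 * sNorm (S - O) + 2 * sNorm (T - O)) (fun v' v => NormRel S v v') (fun v' v => NormRel T v v')
    (Rel_forward S hS V) (Rel_backward T W) (fun v' v w' w hv hw => by
      have := (abs_le.1 (Rel_inner S T O hO v v' w w' hv hw)).2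
      linarith)
  rw [abs_le]
  constructor <;> linarith

lemma uniformContinuous_arccos : UniformContinuous Real.arccos := by
  have h1 : UniformContinuous (fun x : Set.Icc (-1 : ℝ) 1 => Real.arccos x) :=
    CompactSpace.uniformContinuous_of_continuous
      (Real.continuous_arccos.comp continuous_subtype_val)
  have h2 : UniformContinuous (Set.projIcc (-1 : ℝ) 1 (by norm_num)) :=
    (LipschitzWith.projIcc _).uniformContinuous
  have h3 := h1.comp h2
  convert h3 using 1
  ext x
  simp only [Function.comp, Real.arccos, Real.arcsin_projIcc]

lemma limsup_le_of_close (u v : ℕ → ℝ) (B : ℝ) (hu : ∀ n, 0 ≤ u n ∧ u n ≤ B)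
    (hv : ∀ n, 0 ≤ v n ∧ v n ≤ B) (h : ∀ ε > 0, ∀ᶠ n in atTop, |u n - v n| ≤ ε) :
    limsup u atTop ≤ limsup v atTop ∧ liminf u atTop ≤ liminf v atTop := by
  have bb : ∀ w : ℕ → ℝ, (∀ n, 0 ≤ w n ∧ w n ≤ B) → 
      IsBoundedUnder (· ≤ ·) atTop w ∧ IsBoundedUnder (· ≥ ·) atTop w := fun w hw =>
    ⟨isBoundedUnder_of ⟨B, fun n => (hw n).2⟩, isBoundedUnder_of ⟨0, fun n => (hw n).1⟩⟩
  obtain ⟨u1, u2⟩ := bb u hu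
  obtain ⟨v1, v2⟩ := bb v hv
  constructor
  · refine le_of_forall_pos_le_add fun ε hε => ?_
    rw [← limsup_add_const atTop v ε v1 v2.isCoboundedUnder_le]
    refine limsup_le_limsup ?_ u2.isCoboundedUnder_le
      (isBoundedUnder_of ⟨B + ε, fun n => by linarith [(hv n).2]⟩)
    filter_upwards [h ε hε] with n hn
    linarith [(abs_le.1 hn).2]
  · refine le_of_forall_pos_le_add fun ε hε => ?_
    rw [← liminf_add_const atTop v ε v1.isCoboundedUnder_ge v2]
    refine liminf_le_liminf ?_ u2
      (isBoundedUnder_of ⟨B + ε, fun n => by linarith [(hv n).2]⟩ :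
        IsBoundedUnder (· ≤ ·) atTop (fun n => v n + ε)).isCoboundedUnder_ge
    filter_upwards [h ε hε] with n hn
    linarith [(abs_le.1 hn).2]

lemma lims_eq_of_close (u v : ℕ → ℝ) (B : ℝ) (hu : ∀ n, 0 ≤ u n ∧ u n ≤ B)
    (hv : ∀ n, 0 ≤ v n ∧ v n ≤ B) (h : ∀ ε > 0, ∀ᶠ n in atTop, |u n - v n| ≤ ε) :
    limsup u atTop = limsup v atTop ∧ liminf u atTop = liminf v atTop := by
  have a := limsup_le_of_close u v B hu hv h
  have b := limsup_le_of_close v u B hv hu (by simpa only [abs_sub_comm] using h)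
  exact ⟨le_antisymm a.1 b.1, le_antisymm a.2 b.2⟩

lemma iSup_le_of_close {ι : Type*} (f g : ι → ℝ) (B ε : ℝ) (hε : 0 ≤ ε)
    (hg : ∀ i, 0 ≤ g i ∧ g i ≤ B) (h : ∀ i, f i ≤ g i + ε) : ⨆ i, f i ≤ (⨆ i, g i) + ε := by
  refine Real.iSup_le (fun i => (h i).trans ?_) 
    (add_nonneg (Real.iSup_nonneg fun i => (hg i).1) hε)
  have := le_ciSup (f := g) ⟨B, by rintro _ ⟨i, rfl⟩; exact (hg i).2⟩ i
  linarith

lemma abstract_main {ι : Type*} (e : ι ≃ ι) (f g : ι → ℕ → ℝ) (B : ℝ) (hB : 0 ≤ B)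
    (hf : ∀ i n, 0 ≤ f i n ∧ f i n ≤ B) (hg : ∀ i n, 0 ≤ g i n ∧ g i n ≤ B)
    (h : ∀ ε > 0, ∀ᶠ n in atTop, ∀ i, |f i n - g (e i) n| ≤ ε) :
    (⨆ i, limsup (f i) atTop = ⨆ i, limsup (g i) atTop) ∧
    (⨆ i, liminf (f i) atTop = ⨆ i, liminf (g i) atTop) ∧
    (limsup (fun n => ⨆ i, f i n) atTop = limsup (fun n => ⨆ i, g i n) atTop) ∧
    (liminf (fun n => ⨆ i, f i n) atTop = liminf (fun n => ⨆ i, g i n) atTop) := by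
  have h1 : ∀ i, limsup (f i) atTop = limsup (g (e i)) atTop ∧
      liminf (f i) atTop = liminf (g (e i)) atTop := fun i =>
    lims_eq_of_close _ _ B (hf i) (hg (e i)) fun ε hε => (h ε hε).mono fun n hn => hn i
  have h2 := lims_eq_of_close (fun n => ⨆ i, f i n) (fun n => ⨆ i, g i n) B
    (fun n => ⟨Real.iSup_nonneg fun i => (hf i n).1, Real.iSup_le (fun i => (hf i n).2) hB⟩)
    (fun n => ⟨Real.iSup_nonneg fun i => (hg i n).1, Real.iSup_le (fun i => (hg i n).2) hB⟩)
    (fun ε hε => by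
      filter_upwards [h ε hε] with n hn
      have e1 : ⨆ i, g i n = ⨆ i, g (e i) n := (e.iSup_comp (g := fun i => g i n)).symm
      rw [e1]
      have a := iSup_le_of_close (fun i => f i n) (fun i => g (e i) n) B ε hε.le
        (fun i => hg (e i) n) (fun i => by linarith [(abs_le.1 (hn i)).2])
      have b := iSup_le_of_close (fun i => g (e i) n) (fun i => f i n) B ε hε.le
        (fun i => hf i n) (fun i => by linarith [(abs_le.1 (hn i)).1])
      rw [abs_le]
      constructor <;> linarith)
  refine ⟨?_, ?_, h2.1, h2.2⟩
  · rw [← e.iSup_comp (g := fun i => limsup (g i) atTop)]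
    exact iSup_congr fun i => (h1 i).1
  · rw [← e.iSup_comp (g := fun i => liminf (g i) atTop)]
    exact iSup_congr fun i => (h1 i).2

lemma aDisc_div_bounds {d : ℕ} (A : ℕ → Matrix (Fin d) (Fin d) ℝ)
    (V : Submodule ℝ (EuclideanSpace ℝ (Fin d))) (n : ℕ) :
    0 ≤ aDisc A V n / n ∧ aDisc A V n / n ≤ Real.pi := by
  have h0 : 0 ≤ aDisc A V n := Finset.sum_nonneg fun j _ => Real.arccos_nonneg _
  have h1 : aDisc A V n ≤ Real.pi * n := by
    have := Finset.sum_le_card_nsmul (Finset.range n)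
      (fun j => maxAngle (mapMat (PhiD A j) V) (mapMat (PhiD A (j + 1)) V)) Real.pi
      (fun j _ => Real.arccos_le_pi _)
    simpa [aDisc, mul_comm] using this
  exact ⟨by positivity, div_le_of_le_mul₀ (by positivity) Real.pi_pos.le h1⟩

noncomputable def grassEquiv {d : ℕ} (s : ℕ) (S : Matrix (Fin d) (Fin d) ℝ) (hS : IsUnit S) :
    {V : Submodule ℝ (EuclideanSpace ℝ (Fin d)) // finrank ℝ V = s} ≃
    {V : Submodule ℝ (EuclideanSpace ℝ (Fin d)) // finrank ℝ V = s} where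
  toFun V := ⟨mapMat S V.1, by rw [finrank_mapMat S hS, V.2]⟩
  invFun V := ⟨mapMat S⁻¹ V.1, by
    rw [finrank_mapMat _ ((Matrix.isUnit_nonsing_inv_iff).2 hS), V.2]⟩
  left_inv V := by
    apply Subtype.ext
    change mapMat S⁻¹ (mapMat S V.1) = V.1
    rw [← mapMat_mul, Matrix.nonsing_inv_mul _ ((Matrix.isUnit_iff_isUnit_det _).1 hS), mapMat_one]
  right_inv V := by
    apply Subtype.ext
    change mapMat S (mapMat S⁻¹ V.1) = V.1
    rw [← mapMat_mul, Matrix.mul_nonsing_inv _ ((Matrix.isUnit_iff_isUnit_det _).1 hS), mapMat_one]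

lemma sum_close (x y : ℕ → ℝ) (B ε : ℝ) (hε : 0 ≤ ε) (hB : 0 ≤ B) (N : ℕ)
    (h1 : ∀ j, |x j - y j| ≤ B) (h2 : ∀ j ≥ N, |x j - y j| ≤ ε) (n : ℕ) :
    |∑ j ∈ Finset.range n, x j - ∑ j ∈ Finset.range n, y j| ≤ N * B + n * ε := by
  rw [← Finset.sum_sub_distrib]
  refine (Finset.abs_sum_le_sum_abs _ _).trans ?_
  induction n with
  | zero => simp; positivity
  | succ k ih =>
    by_cases hk : N ≤ k
    · rw [Finset.sum_range_succ]
      push_cast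
      linarith [h2 k hk]
    · have h3 := Finset.sum_le_card_nsmul (Finset.range (k + 1)) (fun j => |x j - y j|) B
        (fun j _ => h1 j)
      rw [Finset.card_range, nsmul_eq_mul] at h3
      have h4 : ((k + 1 : ℕ) : ℝ) ≤ N := by exact_mod_cast (by omega)
      have h5 := mul_le_mul_of_nonneg_right h4 hB
      have h6 : 0 ≤ ((k + 1 : ℕ) : ℝ) * ε := by positivity
      linarith

/-- Invariance of all four angular values of `u_{n+1} = A_n u_n` under the kinematic
transformation `Ã_n = Q_{n+1} A_n Q_n⁻¹`, where the invertible matrices `Q_n`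
converge to an orthogonal matrix `Q`. -/
theorem stmt11 (d s : ℕ) (hs : 1 ≤ s) (hsd : s ≤ d)
    (A : ℕ → Matrix (Fin d) (Fin d) ℝ)
    (hinv : ∀ n, IsUnit (A n))
    (hbd : ∃ C : ℝ, ∀ n, sNorm (A n) ≤ C ∧ sNorm (A n)⁻¹ ≤ C)
    (Q : ℕ → Matrix (Fin d) (Fin d) ℝ) (hQinv : ∀ n, IsUnit (Q n))
    (Qlim : Matrix (Fin d) (Fin d) ℝ) (hQorth : Qlimᵀ * Qlim = 1)
    (hQlim : Filter.Tendsto (fun n => sNorm (Q n - Qlim)) atTop (nhds 0))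
    (At : ℕ → Matrix (Fin d) (Fin d) ℝ)
    (hAt : ∀ n, At n = Q (n + 1) * A n * (Q n)⁻¹) :
    thSupLimsup s A = thSupLimsup s At ∧
    thSupLiminf s A = thSupLiminf s At ∧
    thLimsupSup s A = thLimsupSup s At ∧
    thLiminfSup s A = thLiminfSup s At := by
  have key : ∀ ε > 0, ∃ N : ℕ, ∀ j ≥ N, ∀ V W : Submodule ℝ (EuclideanSpace ℝ (Fin d)),
      1 ≤ finrank ℝ V → 1 ≤ finrank ℝ W →
      |maxAngle V W - maxAngle (mapMat (Q j) V) (mapMat (Q (j + 1)) W)| ≤ ε := by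
    intro ε hε
    obtain ⟨δ, hδ, hac⟩ := Metric.uniformContinuous_iff.1 uniformContinuous_arccos ε hε
    obtain ⟨N, hN⟩ := eventually_atTop.1 (hQlim.eventually (gt_mem_nhds (show 0 < δ / 4 by positivity)))
    refine ⟨N, fun j hj V W hV hW => ?_⟩
    have h1 := mval_close (Q j) (Q (j + 1)) Qlim hQorth (hQinv _) (hQinv _) V W hV hW
    have h2 := hN j hj
    have h3 := hN (j + 1) (by omega)
    have h4 : dist (mval V W) (mval (mapMat (Q j) V) (mapMat (Q (j + 1)) W)) < δ := by
      rw [Real.dist_eq, abs_sub_comm]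
      linarith
    exact (hac h4).le
  refine abstract_main (grassEquiv s (Q 0) (hQinv 0)) (fun V n => aDisc A V.1 n / n)
    (fun V n => aDisc At V.1 n / n) Real.pi Real.pi_pos.le
    (fun V n => aDisc_div_bounds A V.1 n) (fun V n => aDisc_div_bounds At V.1 n) ?_
  intro ε hε
  obtain ⟨N, hN⟩ := key (ε / 2) (by positivity)
  obtain ⟨M, hM⟩ := exists_nat_gt (N * Real.pi / (ε / 2))
  filter_upwards [eventually_ge_atTop (M + 1)] with n hn V
  have hnpos : (0 : ℝ) < n := by exact_mod_cast (by omega)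
  have hMn : (M : ℝ) ≤ n := by exact_mod_cast (by omega)
  change |aDisc A V.1 n / n - aDisc At (mapMat (Q 0) V.1) n / n| ≤ ε
  rw [← sub_div, abs_div, abs_of_pos hnpos, div_le_iff₀ hnpos]
  have hfr : ∀ j, 1 ≤ finrank ℝ (mapMat (PhiD A j) V.1) := fun j => by
    rw [finrank_mapMat _ (isUnit_PhiD A hinv j), V.2]
    exact hs
  have hst := sum_close
    (fun j => maxAngle (mapMat (PhiD A j) V.1) (mapMat (PhiD A (j + 1)) V.1))
    (fun j => maxAngle (mapMat (PhiD At j) (mapMat (Q 0) V.1))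
      (mapMat (PhiD At (j + 1)) (mapMat (Q 0) V.1))) Real.pi (ε / 2) (by positivity)
    Real.pi_pos.le N
    (fun j => by
      have a1 := Real.arccos_nonneg
        (mval (mapMat (PhiD A j) V.1) (mapMat (PhiD A (j + 1)) V.1))
      have a2 := Real.arccos_le_pi
        (mval (mapMat (PhiD A j) V.1) (mapMat (PhiD A (j + 1)) V.1))
      have a3 := Real.arccos_nonneg (mval (mapMat (PhiD At j) (mapMat (Q 0) V.1))
        (mapMat (PhiD At (j + 1)) (mapMat (Q 0) V.1)))
      have a4 := Real.arccos_le_pi (mval (mapMat (PhiD At j) (mapMat (Q 0) V.1))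
        (mapMat (PhiD At (j + 1)) (mapMat (Q 0) V.1)))
      change |Real.arccos (mval _ _) - Real.arccos (mval _ _)| ≤ _
      rw [abs_le]
      constructor <;> linarith)
    (fun j hj => by
      simp only [← mapMat_mul, PhiD_transform A At Q hQinv hAt]
      rw [mapMat_mul (Q j), mapMat_mul (Q (j + 1))]
      exact hN j hj _ _ (hfr j) (hfr (j + 1))) n
  refine (show |aDisc A V.1 n - aDisc At (mapMat (Q 0) V.1) n| ≤ _ from hst).trans ?_
  rw [div_lt_iff₀ (by positivity)] at hM
  have := mul_le_mul_of_nonneg_right hMn (show 0 ≤ ε / 2 by positivity)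
  linarith
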